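/- For a complete semitopological semilattice X the following conditions are equivalent: (1) the weak• topology 𝒵_X is Hausdorff; (2) the I-weak topology 𝒲_X is Hausdorff; (3) X is I-separated; (4) X is a V-semilattice satisfying the separation axiom T1; (5) X is a T0-space and 𝒲_X = 𝒵_X; (6) 𝒲_X = Λ_X = 𝒵_X, where Λ_X is the Lawson topology; (7) X is functionally Hausdorff and the Lawson topology Λ_X is Hausdorff. -/

import Mathlib

open Set TopologicalSpace

variable (X : Type*)

/-- The weak• topology `𝒵_X` of a topologized semilattice: generated by the subbase of
complements of closed subsemilattices. -/
def zarTop [SemilatticeInf X] [TopologicalSpace X] : TopologicalSpace X :=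
  TopologicalSpace.generateFrom
    {U : Set X | ∃ S : Set X, IsClosed S ∧ (∀ a ∈ S, ∀ b ∈ S, a ⊓ b ∈ S) ∧ U = Sᶜ}

/-- The weak° topology `η_X` of a topologized semilattice: generated by the base of
open subsemilattices. -/
def etaTop [SemilatticeInf X] [TopologicalSpace X] : TopologicalSpace X :=
  TopologicalSpace.generateFrom
    {U : Set X | IsOpen U ∧ ∀ a ∈ U, ∀ b ∈ U, a ⊓ b ∈ U}

/-- The `𝕀`-weak topology `𝒲_X`: generated by the subbase of preimages of open subsets of
`[0,1]` under continuous homomorphisms `h : X → ([0,1], min)`. -/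
def iweakTop [SemilatticeInf X] [TopologicalSpace X] : TopologicalSpace X :=
  TopologicalSpace.generateFrom
    {V : Set X | ∃ h : X → unitInterval, Continuous h ∧
      (∀ x y : X, h (x ⊓ y) = min (h x) (h y)) ∧
      ∃ U : Set unitInterval, IsOpen U ∧ V = h ⁻¹' U}

/-- `U` is Scott-open: `U = ↑U` and every nonempty up-directed set whose supremum lies in
`U` meets `U`. -/
def ScottOpen [Preorder X] (U : Set X) : Prop :=
  IsUpperSet U ∧ ∀ D : Set X, D.Nonempty → DirectedOn (· ≤ ·) D →
    ∀ a : X, IsLUB D a → a ∈ U → (D ∩ U).Nonempty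

/-- The Lawson topology `Λ_X`: generated by the subbase consisting of Scott-open sets and
complements of upper sets `↑x`. -/
def lawsonTop [Preorder X] : TopologicalSpace X :=
  TopologicalSpace.generateFrom
    ({U : Set X | ScottOpen X U} ∪ {V : Set X | ∃ x : X, V = (Set.Ici x)ᶜ})

/-- The interval topology: generated by the subbase of complements of the sets `↑x`, `↓x`. -/
def intervalTop [Preorder X] : TopologicalSpace X :=
  TopologicalSpace.generateFrom
    ({V : Set X | ∃ x : X, V = (Set.Ici x)ᶜ} ∪ {V : Set X | ∃ x : X, V = (Set.Iic x)ᶜ})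

/-- A topologized semilattice is complete if every nonempty chain `C` has an infimum and a
supremum in `X`, both belonging to the closure of `C`. -/
def CompleteTS [SemilatticeInf X] [TopologicalSpace X] : Prop :=
  ∀ C : Set X, C.Nonempty → IsChain (· ≤ ·) C →
    (∃ a : X, IsGLB C a ∧ a ∈ closure C) ∧ (∃ b : X, IsLUB C b ∧ b ∈ closure C)

open Filter Cardinal Topology

section Directed

variable {P : Type*} [PartialOrder P] [TopologicalSpace P]

/-- In a poset whose nonempty chains have suprema in their closures, so do monotone families
indexed by finite sets. The index type is treated by induction on its cardinality. -/
theorem exists_isLUB_range_of_monotone_finset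
    (hP : ∀ C : Set P, C.Nonempty → IsChain (· ≤ ·) C → ∃ b, IsLUB C b ∧ b ∈ closure C)
    (c : Cardinal) (ι : Type*) (hι : #ι = c) (f : Finset ι → P) (hf : Monotone f) :
    ∃ b, IsLUB (range f) b ∧ b ∈ closure (range f) := by
  induction c using WellFoundedLT.induction generalizing ι with
  | ind c ih =>
    rcases finite_or_infinite ι with hfin | hinf
    · have := Fintype.ofFinite ι
      exact ⟨f Finset.univ, ⟨forall_mem_range.2 fun s => hf s.subset_univ,
        fun u hu => hu (mem_range_self _)⟩, subset_closure (mem_range_self _)⟩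
    · classical
      obtain ⟨_, _, hord⟩ := exists_ord_eq_type_lt ι
      let emb (i : ι) : Finset (Iic i) → Finset ι := Finset.map (Function.Embedding.subtype _)
      have hsup (i : ι) : ∃ b, IsLUB (range (f ∘ emb i)) b ∧ b ∈ closure (range (f ∘ emb i)) :=
        ih _ (hι ▸ mk_Iic_lt i hord (aleph0_le_mk ι)) _ rfl _
          fun s t hst => hf (Finset.map_subset_map.2 hst)
      choose e he hec using hsup
      have hle {i : ι} {s : Finset ι} (hs : ∀ j ∈ s, j ≤ i) : f s ≤ e i := by
        refine (he i).1 ⟨s.subtype (· ∈ Iic i), congrArg f ?_⟩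
        exact Finset.subtype_map_of_mem hs
      have hmono : Monotone e := fun i j hij => (he i).2 <| forall_mem_range.2 fun s =>
        hle fun k hk => by
          obtain ⟨l, -, rfl⟩ := Finset.mem_map.1 hk
          exact le_trans l.2 hij
      obtain ⟨b, hb, hbc⟩ := hP (range e) (range_nonempty e) hmono.isChain_range
      refine ⟨b, ⟨forall_mem_range.2 fun s => ?_, fun u hu => hb.2 <| forall_mem_range.2
        fun i => (he i).2 <| forall_mem_range.2 fun s => hu (mem_range_self _)⟩, ?_⟩
      · rcases s.eq_empty_or_nonempty with rfl | hs
        · exact (hle (i := Classical.arbitrary ι) (by simp)).trans (hb.1 (mem_range_self _))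
        · exact (hle fun j hj => s.le_max' j hj).trans (hb.1 (mem_range_self (s.max' hs)))
      · refine closure_minimal (range_subset_iff.2 fun i => ?_) isClosed_closure hbc
        exact closure_mono (range_comp_subset_range _ _) (hec i)

/-- Iwamura's lemma with closures: chain-completeness implies directed completeness. -/
theorem exists_isLUB_of_directedOn
    (hP : ∀ C : Set P, C.Nonempty → IsChain (· ≤ ·) C → ∃ b, IsLUB C b ∧ b ∈ closure C)
    {D : Set P} (hne : D.Nonempty) (hD : DirectedOn (· ≤ ·) D) :
    ∃ b, IsLUB D b ∧ b ∈ closure D := by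
  classical
  have : Nonempty D := hne.to_subtype
  have hfin (s : Finset D) : ∃ u : D, ∀ a ∈ s, a ≤ u :=
    (directedOn_iff_directed.1 hD).finset_le s
  choose ub hub using hfin
  let f : Finset D → D := fun s => Finset.strongInduction
    (fun s g => ub (s ∪ s.ssubsets.attach.image fun t => g t.1 (Finset.mem_ssubsets.1 t.2))) s
  have hf (s : Finset D) : f s = ub (s ∪ s.ssubsets.attach.image fun t => f t.1) :=
    Finset.strongInduction_eq _ s
  have hmono : Monotone f := by
    intro s t hst
    rcases hst.eq_or_ssubset with rfl | hst
    · exact le_rfl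
    · rw [hf t]
      refine hub _ _ (Finset.mem_union_right _ (Finset.mem_image.2 ?_))
      exact ⟨⟨s, Finset.mem_ssubsets.2 hst⟩, Finset.mem_attach _ _, rfl⟩
  have hle (a : D) : a ≤ f {a} := by
    rw [hf]
    exact hub _ _ (Finset.mem_union_left _ (Finset.mem_singleton_self a))
  obtain ⟨b, hb, hbc⟩ := exists_isLUB_range_of_monotone_finset hP _ D rfl
    (fun s => (f s : P)) hmono
  refine ⟨b, ⟨fun a ha => le_trans (show a ≤ f {⟨a, ha⟩} from hle ⟨a, ha⟩)
    (hb.1 (mem_range_self _)), fun u hu => hb.2 <|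
    forall_mem_range.2 fun s => hu (f s).2⟩, closure_mono ?_ hbc⟩
  exact range_subset_iff.2 fun s => (f s).2

end Directed

section Complete

variable {X : Type*} [SemilatticeInf X] [TopologicalSpace X]

namespace CompleteTS

theorem exists_isLUB (hX : CompleteTS X) {D : Set X} (hne : D.Nonempty)
    (hD : DirectedOn (· ≤ ·) D) : ∃ b, IsLUB D b ∧ b ∈ closure D :=
  exists_isLUB_of_directedOn (fun C hC hchain => (hX C hC hchain).2) hne hD

theorem mem_closure_of_isLUB (hX : CompleteTS X) {D : Set X} (hne : D.Nonempty)
    (hD : DirectedOn (· ≤ ·) D) {b : X} (hb : IsLUB D b) : b ∈ closure D := by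
  obtain ⟨c, hc, hcD⟩ := hX.exists_isLUB hne hD
  exact hb.unique hc ▸ hcD

theorem exists_isGLB (hX : CompleteTS X) {A : Set X} (hne : A.Nonempty) :
    ∃ a, IsGLB A a ∧ a ∈ closure (infClosure A) := by
  have hdir : DirectedOn (α := Xᵒᵈ) (· ≤ ·) (OrderDual.ofDual ⁻¹' (infClosure A : Set X)) :=
    fun a ha b hb => ⟨OrderDual.toDual (OrderDual.ofDual a ⊓ OrderDual.ofDual b),
      infClosed_infClosure (α := X) ha hb, inf_le_left (α := X), inf_le_right (α := X)⟩
  obtain ⟨b, hb, hbc⟩ := exists_isLUB_of_directedOn (P := Xᵒᵈ)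
    (fun C hC hchain => (hX (OrderDual.toDual ⁻¹' C) hC hchain.symm).1)
    (hne.mono (subset_infClosure (α := X))) hdir
  exact ⟨b, isGLB_infClosure.1 hb, hbc⟩

theorem isGLB_mem (hX : CompleteTS X) {A S : Set X} (hne : A.Nonempty) (hAS : A ⊆ S)
    (hS : IsClosed S) (hinf : InfClosed S) {a : X} (ha : IsGLB A a) : a ∈ S := by
  obtain ⟨b, hb, hbc⟩ := hX.exists_isGLB hne
  exact ha.unique hb ▸ closure_minimal (infClosure_min hAS hinf) hS hbc

theorem exists_isLUB_of_bddAbove (hX : CompleteTS X) {A : Set X} (hA : BddAbove A) :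
    ∃ a, IsLUB A a := by
  obtain ⟨a, ha, -⟩ := hX.exists_isGLB hA
  exact ⟨a, isGLB_upperBounds.1 ha⟩

theorem nonempty_isGLB (hX : CompleteTS X) {F : Filter X} [F.NeBot] {T : Set X} (hT : T ∈ F) :
    {m | ∃ B ∈ F, B ⊆ T ∧ IsGLB B m}.Nonempty := by
  obtain ⟨m, hm, -⟩ := hX.exists_isGLB (nonempty_of_mem hT)
  exact ⟨m, T, hT, subset_rfl, hm⟩

theorem directedOn_isGLB (hX : CompleteTS X) (F : Filter X) [F.NeBot] (T : Set X) :
    DirectedOn (· ≤ ·) {m | ∃ B ∈ F, B ⊆ T ∧ IsGLB B m} := by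
  rintro m ⟨B, hB, hBT, hm⟩ m' ⟨B', hB', -, hm'⟩
  obtain ⟨n, hn, -⟩ := hX.exists_isGLB (nonempty_of_mem (inter_mem hB hB'))
  exact ⟨n, ⟨_, inter_mem hB hB', inter_subset_left.trans hBT, hn⟩,
    hn.mono hm inter_subset_left, hn.mono hm' inter_subset_right⟩

/-- Every proper filter has a limit inferior, which belongs to all closed subsemilattices of the
filter. -/
theorem exists_liminf (hX : CompleteTS X) (F : Filter X) [F.NeBot] :
    ∃ w, IsLUB {m | ∃ B ∈ F, B ⊆ univ ∧ IsGLB B m} w ∧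
      ∀ T ∈ F, IsClosed T → InfClosed T → w ∈ T := by
  obtain ⟨w, hw, -⟩ := hX.exists_isLUB (hX.nonempty_isGLB univ_mem) (hX.directedOn_isGLB F univ)
  refine ⟨w, hw, fun T hT hcl hinf => ?_⟩
  obtain ⟨w', hw', hw'c⟩ := hX.exists_isLUB (hX.nonempty_isGLB hT) (hX.directedOn_isGLB F T)
  have hww : w = w' := by
    refine le_antisymm (hw.2 ?_) (hw'.2 ?_)
    · rintro m ⟨B, hB, -, hm⟩
      obtain ⟨n, hn, -⟩ := hX.exists_isGLB (nonempty_of_mem (inter_mem hB hT))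
      exact (hn.mono hm inter_subset_left).trans
        (hw'.1 ⟨_, inter_mem hB hT, inter_subset_right, hn⟩)
    · rintro m ⟨B, hB, -, hm⟩
      exact hw.1 ⟨B, hB, subset_univ B, hm⟩
  rw [hww]
  refine closure_minimal ?_ hcl hw'c
  rintro m ⟨B, hB, hBT, hm⟩
  exact hX.isGLB_mem (nonempty_of_mem hB) hBT hcl hinf hm

theorem ultrafilter_le_nhds_zarTop {F : Ultrafilter X} {w : X}
    (hw : ∀ T ∈ F, IsClosed T → InfClosed T → w ∈ T) : ↑F ≤ @nhds X (zarTop X) w := by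
  refine (tendsto_nhds_generateFrom_iff (m := id)).2 ?_
  rintro _ ⟨S, hS, hinf, rfl⟩ hwS
  refine Ultrafilter.compl_mem_iff_notMem.2 fun hSF => hwS (hw S hSF hS ?_)
  exact fun a ha b hb => hinf a ha b hb

theorem compactSpace_zarTop (hX : CompleteTS X) : @CompactSpace X (zarTop X) := by
  have hlim (F : Ultrafilter X) := hX.exists_liminf (F : Filter X)
  refine @CompactSpace.mk X (zarTop X) ((@isCompact_iff_ultrafilter_le_nhds' X (zarTop X) _).2
    fun F _ => ?_)
  obtain ⟨w, -, hw⟩ := hlim F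
  exact ⟨w, mem_univ _, ultrafilter_le_nhds_zarTop hw⟩

end CompleteTS

end Complete

theorem infClosed_Ici {X : Type*} [SemilatticeInf X] (v : X) : InfClosed (Ici v) :=
  fun _ ha _ hb => le_inf ha hb

section Semitopological

variable {X : Type*} [SemilatticeInf X] [TopologicalSpace X]

theorem isClosed_Ici_of_continuous_inf [T1Space X] (hsemi : ∀ a : X, Continuous fun x => a ⊓ x)
    (v : X) : IsClosed (Ici v) := by
  have : Ici v = (fun x => v ⊓ x) ⁻¹' {v} := by ext x; simp
  exact this ▸ isClosed_singleton.preimage (hsemi v)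

theorem isUpperSet_interior_Ici (hsemi : ∀ a : X, Continuous fun x => a ⊓ x) (v : X) :
    IsUpperSet (interior (Ici v)) := by
  intro u p hup hu
  refine mem_interior.2 ⟨(fun x => u ⊓ x) ⁻¹' interior (Ici v), fun x hx => ?_,
    isOpen_interior.preimage (hsemi u), ?_⟩
  · exact (interior_subset hx).trans inf_le_right
  · rwa [mem_preimage, inf_eq_left.2 hup]

/-- If no `Ici g` with `g` in a finite set is a neighborhood of `x`, then neither is their union. -/
theorem exists_mem_open_forall_not_le (hsemi : ∀ a : X, Continuous fun x => a ⊓ x) {x : X}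
    {O : Set X} (hO : IsOpen O) (hx : x ∈ O) (G : Finset X)
    (hG : ∀ g ∈ G, x ∉ interior (Ici g)) : ∃ p ∈ O, p ≤ x ∧ ∀ g ∈ G, ¬ g ≤ p := by
  classical
  induction G using Finset.induction_on with
  | empty => exact ⟨x, hx, le_rfl, by simp⟩
  | insert g G _ ih =>
    obtain ⟨p, hpO, hpx, hp⟩ := ih fun h hh => hG h (Finset.mem_insert_of_mem hh)
    have hg := hG g (Finset.mem_insert_self _ _)
    have hU : ¬ (fun u => p ⊓ u) ⁻¹' O ⊆ Ici g := fun hsub =>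
      hg (mem_interior.2 ⟨_, hsub, hO.preimage (hsemi p), by
        rwa [mem_preimage, inf_eq_left.2 hpx]⟩)
    obtain ⟨u, huO, hgu⟩ := not_subset.1 hU
    refine ⟨p ⊓ u, huO, inf_le_left.trans hpx, fun h hh => ?_⟩
    rcases Finset.mem_insert.1 hh with rfl | hh
    · exact fun hle => hgu (hle.trans inf_le_right)
    · exact fun hle => hp h hh (hle.trans inf_le_left)

theorem le_zarTop : ‹TopologicalSpace X› ≤ zarTop X := by
  refine le_generateFrom ?_
  rintro _ ⟨S, hS, -, rfl⟩
  exact hS.isOpen_compl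

theorem continuous_iweakTop {h : X → unitInterval} (hc : Continuous h)
    (hh : ∀ a b : X, h (a ⊓ b) = min (h a) (h b)) : Continuous[iweakTop X, _] h :=
  continuous_def.2 fun U hU => isOpen_generateFrom_of_mem ⟨h, hc, hh, U, hU, rfl⟩

theorem zarTop_le_iweakTop : zarTop X ≤ iweakTop X := by
  refine le_generateFrom ?_
  rintro _ ⟨h, hc, hh, U, hU, rfl⟩
  refine continuous_def.1 ?_ U hU
  refine (@OrderTopology.continuous_iff unitInterval X _ _ _ (zarTop X) h).2 fun t => ⟨?_, ?_⟩
  · refine isOpen_generateFrom_of_mem ⟨h ⁻¹' Iic t, isClosed_Iic.preimage hc, ?_, by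
      ext; simp⟩
    intro a ha b _
    rw [mem_preimage, hh]
    exact (min_le_left _ _).trans (show h a ≤ t from ha)
  · refine isOpen_generateFrom_of_mem ⟨h ⁻¹' Ici t, isClosed_Ici.preimage hc, ?_, by
      ext; simp⟩
    intro a ha b hb
    rw [mem_preimage, hh]
    exact le_min (show t ≤ h a from ha) (show t ≤ h b from hb)

theorem t2Space_of_le {Y : Type*} {s t : TopologicalSpace Y} (hst : s ≤ t)
    (ht : @T2Space Y t) : @T2Space Y s :=
  @T2Space.of_injective_continuous Y Y s t ht id Function.injective_id
    (continuous_id_iff_le.2 hst)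

theorem t2Space_of_continuous_real {Y : Type*} [TopologicalSpace Y]
    (hY : ∀ x y : Y, x ≠ y → ∃ f : Y → ℝ, Continuous f ∧ f x ≠ f y) : T2Space Y :=
  ⟨fun x y hxy => by
    obtain ⟨f, hf, hne⟩ := hY x y hxy
    exact separated_by_continuous hf hne⟩

/-- A complete semitopological semilattice with Hausdorff weak• topology is a V-semilattice. -/
theorem CompleteTS.exists_mem_interior_Ici (hX : CompleteTS X)
    (hsemi : ∀ a : X, Continuous fun x => a ⊓ x) (hZ : @T2Space X (zarTop X)) {x y : X}
    (hxy : ¬ x ≤ y) : ∃ v : X, ¬ v ≤ y ∧ x ∈ interior (Ici v) := by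
  by_contra! hV
  let l : Filter X := 𝓝 x ⊓ ⨅ G : Finset {g : X // ¬ g ≤ y}, 𝓟 {p | ∀ g ∈ G, ¬ g.1 ≤ p}
  have hdir : Directed (· ≥ ·)
      (fun G : Finset {g : X // ¬ g ≤ y} => {p | ∀ g ∈ G, ¬ g.1 ≤ p}) := by
    classical
    exact directed_of_isDirected_le fun G H hGH p hp g hg => hp g (Finset.mem_of_subset hGH hg)
  have hl : l.NeBot := by
    refine ((nhds_basis_opens x).inf (hasBasis_iInf_principal hdir)).neBot_iff.2 ?_
    rintro ⟨O, G⟩ ⟨⟨hxO, hO⟩, -⟩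
    obtain ⟨p, hpO, -, hp⟩ := exists_mem_open_forall_not_le hsemi hO hxO
      (G.map (Function.Embedding.subtype _)) (by
        intro g hg
        obtain ⟨g, -, rfl⟩ := Finset.mem_map.1 hg
        exact hV g.1 g.2)
    exact ⟨p, hpO, fun g hg => hp g (Finset.mem_map_of_mem _ hg)⟩
  have hFl := Ultrafilter.of_le l
  obtain ⟨w, hw, hwT⟩ := hX.exists_liminf (Ultrafilter.of l : Filter X)
  have hxw : x = w := (@t2_iff_ultrafilter X (zarTop X)).1 hZ (Ultrafilter.of l)
    ((hFl.trans inf_le_left).trans (nhds_mono le_zarTop))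
    (ultrafilter_le_nhds_zarTop hwT)
  subst hxw
  obtain ⟨m, ⟨B, hB, -, hm⟩, hmy⟩ : ∃ m ∈ {m | ∃ B ∈ (Ultrafilter.of l : Filter X),
      B ⊆ univ ∧ IsGLB B m}, ¬ m ≤ y := by
    by_contra! h
    exact hxy (hw.2 h)
  have hmem : {p | ∀ g ∈ ({⟨m, hmy⟩} : Finset {g : X // ¬ g ≤ y}), ¬ g.1 ≤ p} ∈ l :=
    mem_inf_of_right (mem_iInf_of_mem _ (mem_principal_self _))
  obtain ⟨p, hpB, hp⟩ := Filter.nonempty_of_mem (inter_mem hB (hFl hmem))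
  exact hp _ (Finset.mem_singleton_self _) (hm.1 hpB)

theorem infClosed_closure (hsemi : ∀ a : X, Continuous fun x => a ⊓ x) {S : Set X}
    (hS : InfClosed S) : InfClosed (closure S) := by
  have h1 {a b : X} (ha : a ∈ S) (hb : b ∈ closure S) : a ⊓ b ∈ closure S :=
    map_mem_closure (hsemi a) hb fun c hc => hS ha hc
  intro a ha b hb
  rw [← closure_closure, inf_comm]
  exact map_mem_closure (hsemi b) ha fun c hc => by
    rw [inf_comm]
    exact h1 hc hb

/-- If `𝒲_X` is T0 then continuous homomorphisms to the interval separate points. -/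
theorem exists_hom_ne_of_iweakTop (hW : @T0Space X (iweakTop X)) {x y : X} (hxy : x ≠ y) :
    ∃ h : X → unitInterval, Continuous h ∧
      (∀ a b : X, h (a ⊓ b) = min (h a) (h b)) ∧ h x ≠ h y := by
  by_contra! H
  refine hxy (@T0Space.t0 X (iweakTop X) hW x y ?_)
  refine Eq.trans nhds_generateFrom (Eq.trans ?_ nhds_generateFrom.symm)
  congr! 4 with s
  ext s
  refine and_congr_left ?_
  rintro ⟨h, hc, hh, U, -, rfl⟩
  rw [mem_preimage, mem_preimage, H h hc hh]

theorem t2Space_iweakTop (hsep : ∀ x y : X, x ≠ y → ∃ h : X → unitInterval, Continuous h ∧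
    (∀ a b : X, h (a ⊓ b) = min (h a) (h b)) ∧ h x ≠ h y) : @T2Space X (iweakTop X) := by
  refine @T2Space.mk X (iweakTop X) fun x y hxy => ?_
  obtain ⟨h, hc, hh, hne⟩ := hsep x y hxy
  exact @separated_by_continuous X _ (iweakTop X) _ _ h (continuous_iweakTop hc hh) _ _ hne

theorem t0Space_zarTop [T0Space X] (hsemi : ∀ a : X, Continuous fun x => a ⊓ x) :
    @T0Space X (zarTop X) := by
  refine @T0Space.mk X (zarTop X) fun x y hxy => ?_
  have key {x y : X} (hxy : @Inseparable X (zarTop X) x y) : x ∈ closure {y} := by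
    by_contra hx
    have hopen : IsOpen[zarTop X] (closure {y})ᶜ := isOpen_generateFrom_of_mem
      ⟨_, isClosed_closure, infClosed_closure hsemi infClosed_singleton, rfl⟩
    have := (@Inseparable.mem_open_iff X (zarTop X) _ _ _ hxy hopen).1 hx
    exact this (subset_closure rfl)
  refine T0Space.t0 (inseparable_iff_mem_closure.2 ⟨key hxy, key ?_⟩)
  exact @Inseparable.symm X (zarTop X) _ _ hxy

theorem iweakTop_eq_zarTop (hX : CompleteTS X) (hW : @T2Space X (iweakTop X)) :
    iweakTop X = zarTop X := by
  refine le_antisymm ?_ zarTop_le_iweakTop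
  refine continuous_id_iff_le.1 ?_
  have := hX.compactSpace_zarTop
  exact @Continuous.continuous_symm_of_equiv_compact_to_t2 X X (zarTop X) (iweakTop X) _ _
    (Equiv.refl X) (continuous_id_iff_le.2 zarTop_le_iweakTop)

end Semitopological

section Interpolation

/-- A binary relation with interpolation admits dyadically indexed chains between any two
related elements. -/
theorem exists_dyadic_chain {Y : Type*} {R : Y → Y → Prop}
    (hR : ∀ a b, R a b → ∃ c, R a c ∧ R c b) {a b : Y} (hab : R a b) :
    ∃ d : ℕ → ℕ → Y, d 0 0 = a ∧ d 0 1 = b ∧ (∀ n k, d (n + 1) (2 * k) = d n k) ∧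
      ∀ n k, k < 2 ^ n → R (d n k) (d n (k + 1)) := by
  have hm (p : Y × Y) : ∃ c, R p.1 p.2 → R p.1 c ∧ R c p.2 := by
    by_cases h : R p.1 p.2
    · exact (hR _ _ h).imp fun c hc _ => hc
    · exact ⟨p.1, fun h' => absurd h' h⟩
  choose m hm using hm
  let d : ℕ → ℕ → Y := fun n => Nat.rec (fun k => if k = 0 then a else b)
    (fun _ e k => if k % 2 = 0 then e (k / 2) else m (e (k / 2), e (k / 2 + 1))) n
  have hd (n k) : d (n + 1) k =
      if k % 2 = 0 then d n (k / 2) else m (d n (k / 2), d n (k / 2 + 1)) := rfl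
  refine ⟨d, rfl, rfl, fun n k => by simp [hd], fun n => ?_⟩
  induction n with
  | zero =>
    intro k hk
    obtain rfl : k = 0 := by simpa using hk
    exact hab
  | succ n ih =>
    intro k hk
    have hk2 : k / 2 < 2 ^ n := by rw [pow_succ] at hk; omega
    rcases Nat.mod_two_eq_zero_or_one k with h | h
    · have h1 : (k + 1) % 2 = 1 := by omega
      have h2 : (k + 1) / 2 = k / 2 := by omega
      simpa [hd, h, h1, h2] using (hm (d n (k / 2), d n (k / 2 + 1)) (ih _ hk2)).1
    · have h1 : (k + 1) % 2 = 0 := by omega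
      have h2 : (k + 1) / 2 = k / 2 + 1 := by omega
      simpa [hd, h, h1, h2] using (hm (d n (k / 2), d n (k / 2 + 1)) (ih _ hk2)).2

theorem exists_dyadic_between {s t : ℝ} (hs : 0 ≤ s) (hst : s < t) :
    ∃ n k : ℕ, s < k / 2 ^ n ∧ (k / 2 ^ n : ℝ) < t := by
  obtain ⟨n, hn⟩ := exists_pow_lt_of_lt_one (sub_pos.2 hst) (one_half_lt_one (α := ℝ))
  have h2 : (0 : ℝ) < 2 ^ n := by positivity
  refine ⟨n, ⌊s * 2 ^ n⌋₊ + 1, ?_, ?_⟩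
  · rw [lt_div_iff₀ h2]
    exact_mod_cast Nat.lt_floor_add_one (s * 2 ^ n)
  · rw [div_lt_iff₀ h2]
    have h3 : (⌊s * 2 ^ n⌋₊ : ℝ) ≤ s * 2 ^ n := Nat.floor_le (by positivity)
    have h4 : 1 < (t - s) * 2 ^ n := by
      rw [one_div, inv_pow] at hn
      calc (1 : ℝ) = (2 ^ n)⁻¹ * 2 ^ n := by field_simp
        _ < _ := by gcongr
    push_cast
    linarith

variable {X : Type*} [SemilatticeInf X] [TopologicalSpace X]

/-- If the relation `x ∈ interior (Ici v)` between `v` and `x` has interpolation, then it implies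
that there is a continuous homomorphism to the interval that is `1` at `x` and `0` outside
`Ici v`. -/
theorem exists_hom_of_interpolation (hcl : ∀ v : X, IsClosed (Ici v))
    (hup : ∀ v : X, IsUpperSet (interior (Ici v)))
    (hint : ∀ v x : X, x ∈ interior (Ici v) → ∃ u, u ∈ interior (Ici v) ∧ x ∈ interior (Ici u))
    {v x : X} (hvx : x ∈ interior (Ici v)) :
    ∃ h : X → unitInterval, Continuous h ∧
      (∀ a b : X, h (a ⊓ b) = min (h a) (h b)) ∧ h x = 1 ∧ ∀ y, ¬ v ≤ y → h y = 0 := by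
  obtain ⟨d, hd0, hd1, hdd, hdR⟩ := exists_dyadic_chain (R := fun v x => x ∈ interior (Ici v))
    hint hvx
  have hlt {n k l : ℕ} (hkl : k < l) (hl : l ≤ 2 ^ n) : d n l ∈ interior (Ici (d n k)) := by
    induction l, hkl using Nat.le_induction with
    | base => exact hdR n k hl
    | succ l _ ih => exact hup _ (interior_subset (hdR n l hl)) (ih (by omega))
  have hlift (n j k : ℕ) : d (n + j) (2 ^ j * k) = d n k := by
    induction j with
    | zero => simp
    | succ j ih => rw [← add_assoc, pow_succ', mul_assoc, hdd, ih]
  have hcross {n k n' l : ℕ} (h : (k / 2 ^ n : ℝ) < l / 2 ^ n') (hl : l ≤ 2 ^ n') :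
      d n' l ∈ interior (Ici (d n k)) := by
    rw [← hlift n n' k, ← hlift n' n l, add_comm n' n]
    refine hlt ?_ ?_
    · rw [div_lt_div_iff₀ (by positivity) (by positivity)] at h
      have : k * 2 ^ n' < l * 2 ^ n := by exact_mod_cast h
      linarith
    · rw [pow_add]
      exact Nat.mul_le_mul_left _ hl
  let Q (p : X) : Set ℝ := {q | ∃ n k : ℕ, k ≤ 2 ^ n ∧ q = k / 2 ^ n ∧ d n k ≤ p}
  have hQ1 (p : X) : ∀ q ∈ insert 0 (Q p), q ≤ 1 := by
    rintro q (rfl | ⟨n, k, hk, rfl, -⟩)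
    · exact zero_le_one
    · rw [div_le_one (by positivity)]
      exact_mod_cast hk
  have hbdd (p : X) : BddAbove (insert 0 (Q p)) := ⟨1, hQ1 p⟩
  have hne (p : X) : (insert 0 (Q p)).Nonempty := insert_nonempty _ _
  let g (p : X) : ℝ := sSup (insert 0 (Q p))
  have hg0 (p : X) : 0 ≤ g p := le_csSup (hbdd p) (mem_insert _ _)
  have hg1 (p : X) : g p ≤ 1 := csSup_le (hne p) (hQ1 p)
  have hle {n k : ℕ} {p : X} (hk : k ≤ 2 ^ n) (hp : d n k ≤ p) : (k / 2 ^ n : ℝ) ≤ g p :=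
    le_csSup (hbdd p) (mem_insert_of_mem _ ⟨n, k, hk, rfl, hp⟩)
  have hmem {n k : ℕ} {p : X} (h : (k / 2 ^ n : ℝ) < g p) : p ∈ interior (Ici (d n k)) := by
    obtain ⟨q, (rfl | ⟨n', l, hl, rfl, hp⟩), hq⟩ := exists_lt_of_lt_csSup (hne p) h
    · exact absurd hq (not_lt.2 (by positivity))
    · exact hup _ hp (hcross hq hl)
  have hkle {n k : ℕ} {p : X} (h : (k / 2 ^ n : ℝ) < g p) : k ≤ 2 ^ n := by
    have := h.trans_le (hg1 p)
    rw [div_lt_one (by positivity)] at this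
    exact_mod_cast this.le
  have hmono : Monotone g := fun p p' hpp' => csSup_le_csSup (hbdd p') (hne p) <|
    insert_subset_insert fun q ⟨n, k, hk, hq, hp⟩ => ⟨n, k, hk, hq, hp.trans hpp'⟩
  have hmin (a b : X) : g (a ⊓ b) = min (g a) (g b) := by
    refine le_antisymm (hmono.map_inf_le a b) ?_
    by_contra! hlt
    obtain ⟨n, k, h1, h2⟩ := exists_dyadic_between (hg0 _) hlt
    obtain ⟨ha, hb⟩ := lt_min_iff.1 h2
    exact h1.not_ge (hle (hkle ha) (le_inf (interior_subset (hmem ha))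
      (interior_subset (hmem hb))))
  have hcont : Continuous g := by
    refine OrderTopology.continuous_iff.2 fun t => ⟨?_, ?_⟩
    · refine isOpen_iff_mem_nhds.2 fun p (hp : t < g p) => ?_
      rcases lt_or_ge t 0 with ht | ht
      · exact Filter.univ_mem' fun u => ht.trans_le (hg0 u)
      · obtain ⟨n, k, h1, h2⟩ := exists_dyadic_between ht hp
        exact mem_of_superset (isOpen_interior.mem_nhds (hmem h2)) fun u hu =>
          h1.trans_le (hle (hkle h2) (interior_subset hu))
    · refine isOpen_iff_mem_nhds.2 fun p (hp : g p < t) => ?_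
      obtain ⟨n, k, h1, h2⟩ := exists_dyadic_between (hg0 p) hp
      by_cases hk : k ≤ 2 ^ n
      · refine mem_of_superset ((hcl (d n k)).isOpen_compl.mem_nhds fun h => ?_) fun u hu => ?_
        · exact h1.not_ge (hle hk h)
        · exact (not_lt.1 fun h => hu (interior_subset (hmem h))).trans_lt h2
      · refine Filter.univ_mem' fun u => (hg1 u).trans_lt (lt_of_le_of_lt ?_ h2)
        rw [one_le_div (by positivity)]
        exact_mod_cast (not_le.1 hk).le
  let G (p : X) : unitInterval := ⟨g p, hg0 p, hg1 p⟩
  refine ⟨G, hcont.subtype_mk _, fun a b => ?_, ?_, fun y hy => ?_⟩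
  · refine Subtype.ext ((hmin a b).trans ?_)
    rcases le_total (g a) (g b) with h | h
    · have hG : G a ≤ G b := h
      exact (min_eq_left h).trans (congrArg Subtype.val (min_eq_left hG).symm)
    · have hG : G b ≤ G a := h
      exact (min_eq_right h).trans (congrArg Subtype.val (min_eq_right hG).symm)
  · refine Subtype.ext (le_antisymm (hg1 x) ?_)
    simpa using hle (n := 0) (k := 1) (p := x) (by simp) hd1.le
  · refine Subtype.ext (le_antisymm (not_lt.1 fun (h : 0 < g y) => hy ?_) (hg0 y))
    exact hd0 ▸ interior_subset (hmem (n := 0) (k := 0) (by simpa using h))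

theorem CompleteTS.exists_hom_of_mem_interior_Ici (hX : CompleteTS X) [T1Space X]
    (hsemi : ∀ a : X, Continuous fun x => a ⊓ x)
    (hV : ∀ x y : X, ¬ x ≤ y → ∃ v : X, ¬ v ≤ y ∧ x ∈ interior (Ici v)) {x y : X}
    (hxy : ¬ x ≤ y) : ∃ h : X → unitInterval, Continuous h ∧
      (∀ a b : X, h (a ⊓ b) = min (h a) (h b)) ∧ h x ≠ h y := by
  have hup := isUpperSet_interior_Ici hsemi
  have hint (v x : X) (hvx : x ∈ interior (Ici v)) :
      ∃ u, u ∈ interior (Ici v) ∧ x ∈ interior (Ici u) := by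
    let D : Set X := {u | x ∈ interior (Ici u)}
    have hlub : IsLUB D x := by
      refine ⟨fun u hu => interior_subset hu, fun z hz => ?_⟩
      by_contra hxz
      obtain ⟨u, huz, hu⟩ := hV x z hxz
      exact huz (hz hu)
    have hdir : DirectedOn (· ≤ ·) D := by
      intro a ha b hb
      obtain ⟨j, hj⟩ := hX.exists_isLUB_of_bddAbove (A := {a, b})
        ⟨x, by rintro _ (rfl | rfl); exacts [interior_subset ha, interior_subset hb]⟩
      refine ⟨j, ?_, hj.1 (by simp), hj.1 (by simp)⟩
      have : x ∈ interior (Ici a ∩ Ici b) := by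
        rw [interior_inter]
        exact ⟨ha, hb⟩
      refine interior_mono ?_ this
      rintro z ⟨haz, hbz⟩
      exact hj.2 (by rintro _ (rfl | rfl); exacts [haz, hbz])
    obtain ⟨u, huv, hu⟩ := mem_closure_iff.1 (hX.mem_closure_of_isLUB ⟨v, hvx⟩ hdir hlub) _
      isOpen_interior hvx
    exact ⟨u, huv, hu⟩
  obtain ⟨v, hvy, hvx⟩ := hV x y hxy
  obtain ⟨h, hc, hh, hx, hy⟩ := exists_hom_of_interpolation
    (isClosed_Ici_of_continuous_inf hsemi) hup hint hvx
  exact ⟨h, hc, hh, by rw [hx, hy y hvy]; exact one_ne_zero⟩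

end Interpolation

section FoldInf

variable {X ι : Type*} [SemilatticeInf X]

theorem fold_inf_le (x : X) (a : ι → X) (s : Finset ι) : s.fold (fun u v : X => u ⊓ v) x a ≤ x := by
  classical
  induction s using Finset.induction_on with
  | empty => exact le_rfl
  | insert i s hi ih =>
    rw [Finset.fold_insert hi]
    exact inf_le_right.trans ih

theorem fold_inf_union [DecidableEq ι] (x : X) (a : ι → X) (s t : Finset ι) :
    (s ∪ t).fold (fun u v : X => u ⊓ v) x a =
      s.fold (fun u v : X => u ⊓ v) x a ⊓ t.fold (fun u v : X => u ⊓ v) x a := by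
  induction s using Finset.induction_on with
  | empty => simpa using fold_inf_le x a t
  | insert i s _ ih =>
    rw [Finset.insert_union, Finset.fold_insert_idem, Finset.fold_insert_idem, ih, inf_assoc]

end FoldInf

/-- Choice of a family along a well-order, subject to conditions that depend only on the
earlier values. -/
theorem exists_forall_of_wellFoundedLT {ι Y : Type*} [LinearOrder ι] [WellFoundedLT ι]
    [Nonempty Y] (R : ι → (ι → Y) → Y → Prop)
    (hcongr : ∀ i b b' y, (∀ j < i, b j = b' j) → R i b y → R i b' y)
    (hex : ∀ i b, ∃ y, R i b y) : ∃ a : ι → Y, ∀ i, R i a (a i) := by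
  choose F hF using hex
  let ext (i : ι) (prev : ∀ j, j < i → Y) : ι → Y :=
    fun j => if h : j < i then prev j h else Classical.arbitrary Y
  let a : ι → Y := wellFounded_lt.fix fun i prev => F i (ext i prev)
  have ha (i : ι) : a i = F i (ext i fun j _ => a j) := wellFounded_lt.fix_eq _ _
  refine ⟨a, fun i => hcongr i (ext i fun j _ => a j) a _ (fun j hj => by simp [ext, hj]) ?_⟩
  rw [ha i]
  exact hF _ _

section LowerSets

variable {X : Type*} [SemilatticeInf X] [TopologicalSpace X]

namespace CompleteTS

/-- If `x` lies in the closure of a lower set closed under suprema of chains in a complete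
semitopological semilattice, then any family of continuous functions approximates its values
at `x` by values at one point of the lower set. -/
theorem exists_mem_forall_abs_sub_le (hX : CompleteTS X)
    (hsemi : ∀ a : X, Continuous fun x => a ⊓ x) {K : Set X} (hK : IsLowerSet K)
    (hsup : ∀ C ⊆ K, C.Nonempty → IsChain (· ≤ ·) C → ∀ b, IsLUB C b → b ∈ K)
    {x : X} (hx : x ∈ closure K) (c : Cardinal) (ι : Type*) (hι : #ι = c) (g : ι → X → ℝ)
    (hg : ∀ i, Continuous (g i)) : ∃ y ∈ K, ∀ i, |g i y - g i x| ≤ 1 := by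
  induction c using WellFoundedLT.induction generalizing ι with
  | ind c ih =>
    rcases finite_or_infinite ι with hfin | hinf
    · have hO : IsOpen (⋂ i, {u | |g i u - g i x| < 1}) := isOpen_iInter_of_finite fun i =>
        isOpen_lt (((hg i).sub continuous_const).abs) continuous_const
      obtain ⟨y, hy, hyK⟩ := mem_closure_iff.1 hx _ hO (by simp)
      exact ⟨y, hyK, fun i => (mem_iInter.1 hy i).le⟩
    · classical
      obtain ⟨_, _, hord⟩ := exists_ord_eq_type_lt ι
      let M (a : ι → X) (s : Finset ι) : X := s.fold (fun u v : X => u ⊓ v) x a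
      have hstep (i : ι) (b : ι → X) : ∃ u, u ∈ K ∧ ∀ j ≤ i, ∀ s : Finset ι, (∀ k ∈ s, k < i) →
          |g j (M b s) - g j x| < 1 → |g j (M b s ⊓ u) - g j x| < 1 := by
        have hcard : #(Iic i × Finset (Iio i)) < c := by
          rw [← hι, mk_prod, lift_id, lift_id]
          refine mul_lt_of_lt (aleph0_le_mk ι) (mk_Iic_lt i hord (aleph0_le_mk ι)) ?_
          rcases finite_or_infinite (Iio i) with h | h
          · exact (lt_aleph0_of_finite _).trans_le (aleph0_le_mk ι)
          · rw [mk_finset_of_infinite]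
            exact mk_Iio_lt i hord
        let q (p : Iic i × Finset (Iio i)) : X := M b (p.2.map (Function.Embedding.subtype _))
        obtain ⟨u, huK, hu⟩ := ih _ hcard (Iic i × Finset (Iio i)) rfl
          (fun p z => 2 / (1 - |g p.1 (q p) - g p.1 x|) * g p.1 (q p ⊓ z))
          (fun p => continuous_const.mul ((hg p.1).comp (hsemi _)))
        refine ⟨u, huK, fun j hj s hs hlt => ?_⟩
        have hqs : q (⟨j, hj⟩, s.subtype (· ∈ Iio i)) = M b s :=
          congrArg (M b) (Finset.subtype_map_of_mem hs)
        have h := hu (⟨j, hj⟩, s.subtype (· ∈ Iio i))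
        simp only [hqs] at h
        rw [inf_eq_left.2 (fold_inf_le x b s : M b s ≤ x), ← mul_sub, abs_mul] at h
        have hpos : 0 < 1 - |g j (M b s) - g j x| := sub_pos.2 hlt
        rw [abs_of_pos (div_pos two_pos hpos), div_mul_eq_mul_div, div_le_one hpos] at h
        have := abs_sub_le (g j (M b s ⊓ u)) (g j (M b s)) (g j x)
        linarith
      have : Nonempty X := ⟨x⟩
      obtain ⟨a, ha⟩ := exists_forall_of_wellFoundedLT
        (fun i b u => u ∈ K ∧ ∀ j ≤ i, ∀ s : Finset ι, (∀ k ∈ s, k < i) →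
          |g j (M b s) - g j x| < 1 → |g j (M b s ⊓ u) - g j x| < 1)
        (fun i b b' y hbb' hy => ⟨hy.1, fun j hj s hs => by
          have : M b' s = M b s := Finset.fold_congr fun k hk => (hbb' k (hs k hk)).symm
          rw [this]
          exact hy.2 j hj s hs⟩) hstep
      have hM (j : ι) (s : Finset ι) (hs : ∀ k ∈ s, j ≤ k) : |g j (M a s) - g j x| < 1 := by
        induction s using Finset.induction_on_max with
        | empty => simp [M]
        | insert i s hlt ihs =>
          have : M a (insert i s) = M a s ⊓ a i := by
            rw [inf_comm]
            exact Finset.fold_insert fun hi => lt_irrefl _ (hlt i hi)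
          rw [this]
          exact (ha i).2 j (hs i (Finset.mem_insert_self _ _)) s hlt
            (ihs fun k hk => hs k (Finset.mem_insert_of_mem hk))
      have hclosed (j : ι) : IsClosed {u | |g j u - g j x| ≤ 1} :=
        isClosed_le (((hg j).sub continuous_const).abs) continuous_const
      have hy (i : ι) : ∃ y, IsGLB ((x ⊓ a ·) '' Ici i) y ∧ ∀ j ≤ i, |g j y - g j x| ≤ 1 := by
        obtain ⟨y, hy, hyc⟩ := hX.exists_isGLB (A := (x ⊓ a ·) '' Ici i) (nonempty_Ici.image _)
        have hsub : infClosure ((x ⊓ a ·) '' Ici i) ⊆ {z | ∃ s, (∀ k ∈ s, i ≤ k) ∧ M a s = z} := by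
          refine infClosure_min ?_ ?_
          · rintro _ ⟨k, hk, rfl⟩
            refine ⟨{k}, by simpa using hk, ?_⟩
            simp [M, inf_comm]
          · rintro _ ⟨s, hs, rfl⟩ _ ⟨t, ht, rfl⟩
            refine ⟨s ∪ t, fun k hk => ?_, fold_inf_union x a s t⟩
            exact (Finset.mem_union.1 hk).elim (hs k) (ht k)
        refine ⟨y, hy, fun j hj => closure_minimal ?_ (hclosed j) (closure_mono hsub hyc)⟩
        rintro _ ⟨s, hs, rfl⟩
        exact (hM j s fun k hk => hj.trans (hs k hk)).le
      choose y hy hyg using hy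
      have hmono : Monotone y := fun i j hij =>
        (hy j).mono (hy i) (image_mono (Ici_subset_Ici.2 hij))
      have hyK (i : ι) : y i ∈ K := hK (((hy i).1 (mem_image_of_mem _ self_mem_Ici)).trans
        inf_le_right) (ha i).1
      obtain ⟨z, hz, -⟩ := (hX (range y) (range_nonempty y) hmono.isChain_range).2
      refine ⟨z, hsup _ (range_subset_iff.2 hyK) (range_nonempty y) hmono.isChain_range z hz,
        fun j => ?_⟩
      have hchain : IsChain (· ≤ ·) (y '' Ici j) :=
        hmono.isChain_range.mono (image_subset_range _ _)
      obtain ⟨z', hz', hzc⟩ := (hX (y '' Ici j) (nonempty_Ici.image _) hchain).2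
      have : z = z' := by
        refine le_antisymm (hz.2 ?_) (hz'.mono hz (image_subset_range _ _))
        rintro _ ⟨i, rfl⟩
        exact (hmono (le_max_left i j)).trans (hz'.1 (mem_image_of_mem _ (le_max_right i j)))
      rw [this]
      refine closure_minimal ?_ (hclosed j) hzc
      rintro _ ⟨i, hi, rfl⟩
      exact hyg i j hi

theorem isClosed_of_isLowerSet (hX : CompleteTS X)
    (hsemi : ∀ a : X, Continuous fun x => a ⊓ x)
    (hfun : ∀ x y : X, x ≠ y → ∃ f : X → ℝ, Continuous f ∧ f x ≠ f y)
    {K : Set X} (hK : IsLowerSet K)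
    (hsup : ∀ C ⊆ K, C.Nonempty → IsChain (· ≤ ·) C → ∀ b, IsLUB C b → b ∈ K) : IsClosed K := by
  refine isClosed_of_closure_subset fun x hx => ?_
  obtain ⟨y, hyK, hy⟩ := hX.exists_mem_forall_abs_sub_le hsemi hK hsup hx _
    {g : X → ℝ // Continuous g} rfl (fun g => g.1) fun g => g.2
  suffices x = y from this ▸ hyK
  by_contra hxy
  obtain ⟨f, hf, hne⟩ := hfun x y hxy
  have hpos : 0 < |f y - f x| := abs_pos.2 (sub_ne_zero.2 hne.symm)
  have := hy ⟨fun z => 2 / |f y - f x| * f z, continuous_const.mul hf⟩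
  simp only [← mul_sub, abs_mul, abs_div, abs_abs, Nat.abs_ofNat] at this
  rw [div_mul_cancel₀ _ hpos.ne'] at this
  norm_num at this

end CompleteTS

end LowerSets

section LawsonTopology

variable {X : Type*} [SemilatticeInf X]

theorem t0Space_lawsonTop : @T0Space X (lawsonTop X) := by
  refine @T0Space.mk X (lawsonTop X) fun x y hxy => ?_
  have hmem (p : X) : x ∈ (Ici p)ᶜ ↔ y ∈ (Ici p)ᶜ :=
    @Inseparable.mem_open_iff X (lawsonTop X) _ _ _ hxy
      (isOpen_generateFrom_of_mem (Or.inr ⟨p, rfl⟩))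
  simp only [mem_compl_iff, mem_Ici, not_iff_not] at hmem
  exact le_antisymm ((hmem x).1 le_rfl) ((hmem y).2 le_rfl)

theorem zarTop_lawsonTop_le : @zarTop X _ (lawsonTop X) ≤ lawsonTop X := by
  refine le_generateFrom ?_
  rintro U (hU | ⟨p, rfl⟩)
  · refine isOpen_generateFrom_of_mem ⟨Uᶜ, ?_, fun a ha b _ => ?_, (compl_compl U).symm⟩
    · refine (@isOpen_compl_iff X Uᶜ (lawsonTop X)).1 ?_
      rw [compl_compl]
      exact isOpen_generateFrom_of_mem (Or.inl hU)
    · exact fun h => ha (hU.1 inf_le_left h)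
  · refine isOpen_generateFrom_of_mem ⟨Ici p, ?_, infClosed_Ici p, rfl⟩
    exact (@isOpen_compl_iff X (Ici p) (lawsonTop X)).1
      (isOpen_generateFrom_of_mem (Or.inr ⟨p, rfl⟩))

theorem mem_closure_generateFrom_of_directedOn {P : Type*} [Preorder P] {g : Set (Set P)}
    {C : Set P} (hne : C.Nonempty) (hC : DirectedOn (· ≤ ·) C) {b : P}
    (hb : ∀ U ∈ g, b ∈ U → ∃ c ∈ C, ∀ c' ∈ C, c ≤ c' → c' ∈ U) :
    b ∈ @closure P (generateFrom g) C := by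
  have : Nonempty C := hne.to_subtype
  have : IsDirectedOrder C := ⟨directedOn_iff_directed.1 hC⟩
  refine @mem_closure_of_tendsto P (generateFrom g) C b C (↑) atTop _
    (tendsto_nhds_generateFrom_iff.2 fun U hU hbU => ?_) (.of_forall fun c => c.2)
  obtain ⟨c, hc, hcU⟩ := hb U hU hbU
  exact mem_of_superset (Ici_mem_atTop (⟨c, hc⟩ : C)) fun c' hc' => hcU c' c'.2 hc'

variable [TopologicalSpace X]

namespace CompleteTS

theorem isOpen_zarTop_of_scottOpen (hX : CompleteTS X) (hZ : @T2Space X (zarTop X)) {U : Set X}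
    (hU : ScottOpen X U) : IsOpen[zarTop X] U := by
  refine (@isOpen_iff_ultrafilter X U (zarTop X)).2 fun x hx F hF => ?_
  obtain ⟨w, hw, hwT⟩ := hX.exists_liminf (F : Filter X)
  obtain rfl : x = w := (@t2_iff_ultrafilter X (zarTop X)).1 hZ F hF
    (ultrafilter_le_nhds_zarTop hwT)
  obtain ⟨m, ⟨B, hB, -, hm⟩, hmU⟩ := hU.2 _ (hX.nonempty_isGLB univ_mem)
    (hX.directedOn_isGLB F univ) x hw hx
  exact mem_of_superset hB fun b hb => hU.1 (hm.1 hb) hmU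

theorem zarTop_le_lawsonTop [T1Space X] (hX : CompleteTS X)
    (hsemi : ∀ a : X, Continuous fun x => a ⊓ x) (hZ : @T2Space X (zarTop X)) :
    zarTop X ≤ lawsonTop X := by
  refine le_generateFrom ?_
  rintro U (hU | ⟨p, rfl⟩)
  · exact hX.isOpen_zarTop_of_scottOpen hZ hU
  · exact isOpen_generateFrom_of_mem
      ⟨Ici p, isClosed_Ici_of_continuous_inf hsemi p, infClosed_Ici p, rfl⟩

theorem lawsonTop_le_iweakTop (hX : CompleteTS X) : lawsonTop X ≤ iweakTop X := by
  refine le_generateFrom ?_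
  rintro _ ⟨h, hc, hh, U, hU, rfl⟩
  have hmono : Monotone h := fun a b hab => by
    rw [← inf_eq_left.2 hab, hh]
    exact min_le_right _ _
  refine continuous_def.1 ?_ U hU
  refine (@OrderTopology.continuous_iff unitInterval X _ _ _ (lawsonTop X) h).2
    fun t => ⟨isOpen_generateFrom_of_mem (Or.inl ⟨fun a b hab ha => ?_, ?_⟩), ?_⟩
  · exact lt_of_lt_of_le (show t < h a from ha) (hmono hab)
  · intro D hne hD a ha hat
    obtain ⟨d, hdt, hd⟩ := mem_closure_iff.1 (hX.mem_closure_of_isLUB hne hD ha) _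
      (isOpen_Ioi.preimage hc) hat
    exact ⟨d, hd, hdt⟩
  · rcases (h ⁻¹' Ici t).eq_empty_or_nonempty with hemp | hne
    · have : h ⁻¹' Iio t = Set.univ := by rw [← compl_Ici, preimage_compl, hemp, compl_empty]
      exact this ▸ @isOpen_univ X (lawsonTop X)
    · obtain ⟨p, hp, -⟩ := hX.exists_isGLB hne
      have hpt : t ≤ h p := hX.isGLB_mem hne subset_rfl (isClosed_Ici.preimage hc)
        (fun a ha b hb => by
          rw [mem_preimage, hh]
          exact le_min (show t ≤ h a from ha) (show t ≤ h b from hb)) hp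
      refine isOpen_generateFrom_of_mem (Or.inr ⟨p, ?_⟩)
      ext z
      exact ⟨fun hz hpz => (hpt.trans (hmono hpz)).not_gt hz,
        fun hz => (not_le.1 fun htz => hz (hp.1 htz) : h z < t)⟩

theorem completeTS_lawsonTop (hX : CompleteTS X) : @CompleteTS X _ (lawsonTop X) := by
  intro C hne hC
  obtain ⟨⟨a, ha, -⟩, b, hb, -⟩ := hX C hne hC
  refine ⟨⟨a, ha, ?_⟩, b, hb, ?_⟩
  · refine mem_closure_generateFrom_of_directedOn (P := Xᵒᵈ) (C := OrderDual.ofDual ⁻¹' C) hne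
      (IsChain.directedOn (α := Xᵒᵈ) hC.symm) ?_
    rintro U (hU | ⟨p, rfl⟩) haU
    · obtain ⟨c, hc⟩ := hne
      exact ⟨c, hc, fun c' hc' _ => hU.1 (ha.1 hc') haU⟩
    · obtain ⟨c, hc, hpc⟩ : ∃ c ∈ C, ¬ p ≤ c := by
        by_contra! h
        exact haU (ha.2 h)
      exact ⟨c, hc, fun c' _ hcc' hpc' => hpc (le_trans (α := X) hpc' hcc')⟩
  · refine mem_closure_generateFrom_of_directedOn hne hC.directedOn ?_
    rintro U (hU | ⟨p, rfl⟩) hbU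
    · obtain ⟨c, hc, hcU⟩ := hU.2 C hne hC.directedOn b hb hbU
      exact ⟨c, hc, fun c' _ hcc' => hU.1 hcc' hcU⟩
    · obtain ⟨c, hc⟩ := hne
      exact ⟨c, hc, fun c' hc' _ hpc' => hbU (le_trans hpc' (hb.1 hc'))⟩

theorem isLUB_inf_image [T2Space X] (hX : CompleteTS X)
    (hsemi : ∀ a : X, Continuous fun x => a ⊓ x) {D : Set X} (hne : D.Nonempty)
    (hD : DirectedOn (· ≤ ·) D) {b : X} (hb : IsLUB D b) (a : X) :
    IsLUB ((a ⊓ ·) '' D) (a ⊓ b) := by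
  refine ⟨forall_mem_image.2 fun d hd => inf_le_inf_left a (hb.1 hd), fun u hu => ?_⟩
  have hcl : IsClosed {d | u ⊓ (a ⊓ d) = a ⊓ d} :=
    isClosed_eq ((hsemi u).comp (hsemi a)) (hsemi a)
  exact inf_eq_right.1 (closure_minimal (fun d hd => inf_eq_right.2 (hu (mem_image_of_mem _ hd)))
    hcl (hX.mem_closure_of_isLUB hne hD hb))

theorem continuous_inf_lawsonTop [T2Space X] (hX : CompleteTS X)
    (hsemi : ∀ a : X, Continuous fun x => a ⊓ x) (a : X) :
    @Continuous X X (lawsonTop X) (lawsonTop X) fun x => a ⊓ x := by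
  refine continuous_generateFrom_iff.2 ?_
  rintro U (hU | ⟨p, rfl⟩)
  · refine isOpen_generateFrom_of_mem (Or.inl ⟨fun x y hxy hx => ?_, fun D hne hD b hb hbU => ?_⟩)
    · exact hU.1 (inf_le_inf_left a hxy) hx
    · have hdir : DirectedOn (· ≤ ·) ((a ⊓ ·) '' D) :=
        hD.mono_comp fun x y hxy => inf_le_inf_left a hxy
      obtain ⟨_, ⟨d, hd, rfl⟩, hdU⟩ := hU.2 _ (hne.image _) hdir _
        (hX.isLUB_inf_image hsemi hne hD hb a) hbU
      exact ⟨d, hd, hdU⟩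
  · by_cases hpa : p ≤ a
    · refine isOpen_generateFrom_of_mem (Or.inr ⟨p, ?_⟩)
      ext x
      simp [hpa]
    · convert @isOpen_univ X (lawsonTop X)
      ext x
      simp [hpa]

theorem exists_mem_interior_Ici_of_lawsonTop (hX : CompleteTS X)
    (hsemi : ∀ a : X, Continuous fun x => a ⊓ x)
    (hfun : ∀ x y : X, x ≠ y → ∃ f : X → ℝ, Continuous f ∧ f x ≠ f y)
    (hL : @T2Space X (lawsonTop X)) {x y : X} (hxy : ¬ x ≤ y) :
    ∃ v : X, ¬ v ≤ y ∧ x ∈ interior (Ici v) := by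
  have := t2Space_of_continuous_real hfun
  have hXL := hX.completeTS_lawsonTop
  have hsemiL := hX.continuous_inf_lawsonTop hsemi
  obtain ⟨v, hvy, hxv⟩ := @CompleteTS.exists_mem_interior_Ici X _ (lawsonTop X) hXL hsemiL
    (t2Space_of_le zarTop_lawsonTop_le hL) x y hxy
  refine ⟨v, hvy, mem_interior.2 ⟨_, @interior_subset X (lawsonTop X) (Ici v), ?_, hxv⟩⟩
  refine isClosed_compl_iff.1 (hX.isClosed_of_isLowerSet hsemi hfun ?_ ?_)
  · exact (@isUpperSet_interior_Ici X _ (lawsonTop X) hsemiL v).compl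
  · intro C hCK hne hC b hb
    obtain ⟨c, hc, hcC⟩ := (hXL C hne hC).2
    rw [hb.unique hc]
    refine @closure_minimal X (lawsonTop X) C _ hCK ?_ c hcC
    exact (@isClosed_compl_iff X (lawsonTop X) _).2
      (@isOpen_interior X (lawsonTop X) _)

end CompleteTS

end LawsonTopology

/-- For a complete semitopological semilattice `X` the following are
equivalent: (1) `𝒵_X` is Hausdorff; (2) `𝒲_X` is Hausdorff; (3) `X` is `𝕀`-separated;
(4) `X` is a V-semilattice satisfying T1; (5) `X` is a T0-space and `𝒲_X = 𝒵_X`;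
(6) `𝒲_X = Λ_X = 𝒵_X`; (7) `X` is functionally Hausdorff and the Lawson topology `Λ_X`
is Hausdorff. -/
theorem stmt19 {X : Type*} [SemilatticeInf X] [TopologicalSpace X]
    (hsemi : ∀ a : X, Continuous fun x => a ⊓ x)
    (hcomp : CompleteTS X) :
    List.TFAE
      [@T2Space X (zarTop X),
       @T2Space X (iweakTop X),
       ∀ x y : X, x ≠ y → ∃ h : X → unitInterval, Continuous h ∧
         (∀ a b : X, h (a ⊓ b) = min (h a) (h b)) ∧ h x ≠ h y,
       (∀ x y : X, ¬ x ≤ y → ∃ v : X, v ∉ Set.Iic y ∧ x ∈ interior (Set.Ici v)) ∧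
         T1Space X,
       T0Space X ∧ iweakTop X = zarTop X,
       iweakTop X = lawsonTop X ∧ lawsonTop X = zarTop X,
       (∀ x y : X, x ≠ y → ∃ f : X → ℝ, Continuous f ∧ f x ≠ f y) ∧
         @T2Space X (lawsonTop X)] := by
  tfae_have 1 → 4 := fun hZ => by
    have : T2Space X := t2Space_of_le le_zarTop hZ
    exact ⟨fun x y hxy => hcomp.exists_mem_interior_Ici hsemi hZ hxy, inferInstance⟩
  tfae_have 4 → 3 := fun ⟨hV, hT1⟩ x y hxy => by
    by_cases hle : x ≤ y
    · obtain ⟨h, hc, hh, hne⟩ := hcomp.exists_hom_of_mem_interior_Ici hsemi hV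
        fun hyx => hxy (le_antisymm hle hyx)
      exact ⟨h, hc, hh, hne.symm⟩
    · exact hcomp.exists_hom_of_mem_interior_Ici hsemi hV hle
  tfae_have 3 → 2 := t2Space_iweakTop
  tfae_have 2 → 1 := t2Space_of_le zarTop_le_iweakTop
  tfae_have 2 → 5 := fun hW => by
    have : T2Space X := t2Space_of_le (le_zarTop.trans zarTop_le_iweakTop) hW
    exact ⟨inferInstance, iweakTop_eq_zarTop hcomp hW⟩
  tfae_have 5 → 3 := fun ⟨_, hWZ⟩ x y hxy =>
    exists_hom_ne_of_iweakTop (hWZ ▸ t0Space_zarTop hsemi) hxy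
  tfae_have 2 → 6 := fun hW => by
    have hWZ := iweakTop_eq_zarTop hcomp hW
    have hZ : @T2Space X (zarTop X) := hWZ ▸ hW
    have : T2Space X := t2Space_of_le le_zarTop hZ
    have hZL := hcomp.zarTop_le_lawsonTop hsemi hZ
    have hLW := hcomp.lawsonTop_le_iweakTop
    exact ⟨le_antisymm (hWZ.trans_le hZL) hLW, le_antisymm (hLW.trans_eq hWZ) hZL⟩
  tfae_have 6 → 3 := fun ⟨hWL, _⟩ x y hxy =>
    exists_hom_ne_of_iweakTop (hWL ▸ t0Space_lawsonTop) hxy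
  tfae_have 2 → 7 := fun hW => by
    have hWL := (tfae_2_to_6 hW).1
    refine ⟨fun x y hxy => ?_, hWL ▸ hW⟩
    obtain ⟨h, hc, -, hne⟩ := exists_hom_ne_of_iweakTop (@T1Space.t0Space X (iweakTop X)
      (@T2Space.t1Space X (iweakTop X) hW)) hxy
    exact ⟨fun z => h z, continuous_subtype_val.comp hc, fun he => hne (Subtype.ext he)⟩
  tfae_have 7 → 4 := fun ⟨hfun, hL⟩ => by
    have := t2Space_of_continuous_real hfun
    exact ⟨fun x y hxy => hcomp.exists_mem_interior_Ici_of_lawsonTop hsemi hfun hL hxy,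
      inferInstance⟩
  tfae_finish
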